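/- Let n be a nonnegative integer and let a, c ∈ ℂ satisfy c + j ≠ 0 for 0 ≤ j ≤ n−1, 1−c−n+j ≠ 0 for 0 ≤ j ≤ ⌊n/2⌋, and c−a+n+j ≠ 0 for 0 ≤ j ≤ ⌊(n+1)/2⌋−1. Then (c−a)_n/(c)_n = Σ_{k=0}^{⌊n/2⌋} C(n,2k) (−1)^k (1−c−k) (1−a)_{2k} (c−a)_k / ((c−a+n)_k (1−c−n)_{k+1} (c)_k) − Σ_{0 ≤ 2k+1 ≤ n} C(n,2k+1) (−1)^k (1+c−a+3k) (1−a)_{2k+1} (c−a)_k / ((c−a+n)_{k+1} (1−c−n)_{k+1} (c)_k). (Fourth-type reciprocal relation dual to the Chu–Vandermonde–Gauß summation formula, first form.) -/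

import Mathlib

/-- Rising factorial (Pochhammer symbol) of a complex number:
`poch x 0 = 1` and `poch x (m+1) = poch x m * (x + m)`. -/
noncomputable def poch (x : ℂ) : ℕ → ℂ
  | 0 => 1
  | m + 1 => poch x m * (x + (m : ℂ))

theorem poch_add (x : ℂ) (m k : ℕ) : poch x (m + k) = poch x m * poch (x + m) k := by
  induction k with
  | zero => simp [poch]
  | succ k ih =>
    rw [← add_assoc, poch, ih, poch]; push_cast; ring

theorem poch_one_add (x : ℂ) (k : ℕ) : poch x (k + 1) = x * poch (x + 1) k := by
  rw [add_comm k 1, poch_add]; simp [poch]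

theorem poch_ne (x : ℂ) (m : ℕ) (h : ∀ j : ℕ, j < m → x + (j : ℂ) ≠ 0) : poch x m ≠ 0 := by
  induction m with
  | zero => simp [poch]
  | succ m ih =>
    rw [poch]
    exact mul_ne_zero (ih fun j hj => h j (by omega)) (h m (by omega))

/-- reflection -/
theorem poch_refl (x : ℂ) (m : ℕ) : poch (1 - x) m = (-1) ^ m * poch (x - m) m := by
  induction m generalizing x with
  | zero => simp [poch]
  | succ m ih =>
    rw [poch, ih, poch_one_add]
    have : x - ((m + 1 : ℕ) : ℂ) + 1 = x - m := by push_cast; ring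
    rw [this]; push_cast; ring

theorem vander (N : ℕ) (x y : ℂ) :
    ∑ k ∈ Finset.range (N + 1), (-1 : ℂ) ^ k * (N.choose k : ℂ) *
      (poch x k * poch (y + k) (N - k)) = poch (y - x) N := by
  induction N generalizing x y with
  | zero => simp [poch]
  | succ N ih =>
    rw [Finset.sum_range_succ']
    have h1 : ∀ k ∈ Finset.range (N + 1), (-1 : ℂ) ^ (k + 1) * ((N + 1).choose (k + 1) : ℂ) *
        (poch x (k + 1) * poch (y + ((k + 1 : ℕ) : ℂ)) (N + 1 - (k + 1)))
        = (-x) * ((-1 : ℂ) ^ k * (N.choose k : ℂ) *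
            (poch (x + 1) k * poch (y + 1 + k) (N - k)))
          + (-1 : ℂ) ^ (k + 1) * (N.choose (k + 1) : ℂ) *
        (poch x (k + 1) * poch (y + ((k + 1 : ℕ) : ℂ)) (N + 1 - (k + 1))) := by
      intro k _
      rw [Nat.choose_succ_succ, poch_one_add, Nat.add_sub_add_right]
      have : y + ((k + 1 : ℕ) : ℂ) = y + 1 + k := by push_cast; ring
      rw [this]; push_cast; ring
    rw [Finset.sum_congr rfl h1, Finset.sum_add_distrib, ← Finset.mul_sum, ih, add_assoc]
    have h2 := Finset.sum_range_succ' (fun k : ℕ => (-1 : ℂ) ^ k * (N.choose k : ℂ) *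
        (poch x k * poch (y + (k : ℂ)) (N + 1 - k))) (N + 1)
    have h0 : ((N + 1).choose 0 : ℂ) = (N.choose 0 : ℂ) := by simp
    rw [h0, ← h2, Finset.sum_range_succ, Nat.choose_succ_self]
    have h3 : ∀ k ∈ Finset.range (N + 1), (-1 : ℂ) ^ k * (N.choose k : ℂ) *
        (poch x k * poch (y + (k : ℂ)) (N + 1 - k)) = (y + N) * ((-1 : ℂ) ^ k * (N.choose k : ℂ) *
        (poch x k * poch (y + (k : ℂ)) (N - k))) := by
      intro k hk
      have hk : k ≤ N := by simpa [Nat.lt_succ_iff] using hk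
      rw [Nat.succ_sub hk, poch, Nat.cast_sub hk]; ring
    rw [Finset.sum_congr rfl h3, ← Finset.mul_sum, ih, poch.eq_2 (y - x)]
    have : y + 1 - (x + 1) = y - x := by ring
    rw [this]; push_cast; ring

theorem poch_swap (c : ℂ) (p q k : ℕ) (hk : k ≤ p + q) :
    poch (c + k - q) q * poch c p = poch (c - q + k) (p + q - k) * poch c k := by
  have e : c - q + k = c + k - (q : ℂ) := by ring
  rw [e]
  rcases le_total k p with h | h
  · obtain ⟨d, rfl⟩ := Nat.exists_eq_add_of_le h
    have : k + d + q - k = q + d := by omega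
    rw [this, poch_add c, poch_add _ q d]
    have : c + k - (q : ℂ) + q = c + k := by ring
    rw [this]; ring
  · obtain ⟨d, rfl⟩ := Nat.exists_eq_add_of_le h
    obtain ⟨r, rfl⟩ := Nat.exists_eq_add_of_le (show d ≤ q by omega)
    have : p + (d + r) - (p + d) = r := by omega
    rw [this, poch_add c, add_comm d r, poch_add _ r d]
    have : c + ((p + d : ℕ) : ℂ) - ((r + d : ℕ) : ℂ) + r = c + p := by push_cast; ring
    rw [this]; ring

/-- The direct (Chu–Vandermonde) sum. -/
theorem direct_sum (a c : ℂ) (p q : ℕ)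
    (hc : ∀ j : ℕ, j < p + q → c + (j : ℂ) ≠ 0) :
    ∑ k ∈ Finset.range (p + q + 1), (-1 : ℂ) ^ k * ((p + q).choose k : ℂ) *
      ((poch (c - a + k) p * poch (1 - c - k) q) * (poch (c - a) k / poch c k))
      = (-1) ^ p * poch (1 - a - p + (p : ℂ)) (p + q) * poch (c - a) p / poch c p := by
  have hp : poch c p ≠ 0 := poch_ne _ _ fun j hj => hc j (by omega)
  have h : ∀ k ∈ Finset.range (p + q + 1), (-1 : ℂ) ^ k * ((p + q).choose k : ℂ) *
      ((poch (c - a + k) p * poch (1 - c - k) q) * (poch (c - a) k / poch c k))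
      = ((-1) ^ q * poch (c - a) p / poch c p) * ((-1 : ℂ) ^ k * ((p + q).choose k : ℂ) *
      (poch (c - a + p) k * poch (c - q + k) (p + q - k))) := by
    intro k hk
    have hk : k ≤ p + q := by simpa [Nat.lt_succ_iff] using hk
    have hk0 : poch c k ≠ 0 := poch_ne _ _ fun j hj => hc j (by omega)
    have h1 := poch_swap c p q k hk
    have h2 : poch (c - a) k * poch (c - a + k) p = poch (c - a) p * poch (c - a + p) k := by
      rw [← poch_add, ← poch_add, add_comm]
    have h3 : poch (1 - c - k) q = (-1) ^ q * poch (c + k - q) q := by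
      rw [← poch_refl]; congr 1; ring
    rw [h3]
    field_simp
    linear_combination ((p + q).choose k : ℂ) *
      (poch (c + k - q) q * poch c p * h2 + poch (c - a) p * poch (c - a + p) k * h1)
  rw [Finset.sum_congr rfl h, ← Finset.mul_sum, vander]
  have h4 : poch (1 - a - p + (p : ℂ)) (p + q) = (-1) ^ (p + q) * poch (c - q - (c - a + p)) (p + q) := by
    have e : 1 - a - p + (p : ℂ) = 1 - a := by ring
    rw [e, poch_refl]; congr 2; push_cast; ring
  rw [h4, pow_add]
  have : ((-1 : ℂ) ^ p) * (-1) ^ p = 1 := by rw [← mul_pow]; simp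
  linear_combination (- (-1 : ℂ) ^ q * poch (c - a) p / poch c p *
    poch (c - q - (c - a + p)) (p + q)) * this

theorem gh_tel (φ : ℂ → ℕ → ℂ) (A B : ℕ → ℂ)
    (hφ : ∀ x m, φ x (m + 1) = φ x m * (A m + x * B m)) (k M J : ℕ) (x : ℂ) (hx : x = k + M + 1)
    (hJ : ∀ j ≤ J, φ x (k + j + 1) ≠ 0) :
    ∑ j ∈ Finset.range (J + 1), (-1 : ℂ) ^ j * ((M + 1).choose j : ℂ) *
      ((A (k + j) + ((k + j : ℕ) : ℂ) * B (k + j)) * φ k (k + j) / φ x (k + j + 1))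
     = (-1) ^ J * (M.choose J : ℂ) * (φ k (k + J + 1) / φ x (k + J + 1)) := by
  induction J with
  | zero => simp [hφ k]; ring
  | succ J ih =>
    rw [Finset.sum_range_succ, ih fun j hj => hJ j (by omega)]
    have n1 := hJ J (by omega)
    have n2 := hJ (J + 1) le_rfl
    have e : k + (J + 1) = k + J + 1 := by ring
    rw [e] at n2 ⊢
    have n3 := n2
    rw [hφ] at n3
    have n4 := right_ne_zero_of_mul n3
    rw [hφ k (k + J + 1), hφ x (k + J + 1)]
    have c1 : ((M + 1).choose (J + 1) : ℂ) = M.choose J + M.choose (J + 1) := by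
      exact_mod_cast Nat.choose_succ_succ M J
    have c2 : ((M + 1).choose (J + 1) : ℂ) * (J + 1) = (M + 1) * M.choose J := by
      exact_mod_cast (Nat.add_one_mul_choose_eq M J).symm
    generalize φ x (k + J + 1) = P at *
    generalize φ k (k + J + 1) = Q at *
    generalize A (k + J + 1) = a at *
    generalize B (k + J + 1) = b at *
    obtain ⟨L, hL⟩ : ∃ L, L = a + x * b := ⟨_, rfl⟩
    rw [← hL] at n4 ⊢
    field_simp
    rw [hL]
    subst hx
    push_cast
    rw [pow_succ]
    generalize (((M + 1).choose (J + 1) : ℕ) : ℂ) = C1 at *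
    linear_combination (-(-1 : ℂ) ^ J * Q * (a + k * b)) * c1 - (-1 : ℂ) ^ J * Q * b * c2

theorem gh_inv (φ : ℂ → ℕ → ℂ) (A B : ℕ → ℂ) (g : ℕ → ℂ)
    (hφ : ∀ x m, φ x (m + 1) = φ x m * (A m + x * B m)) (n : ℕ)
    (hn : ∀ j ≤ n, φ n (j + 1) ≠ 0) :
    ∑ m ∈ Finset.range (n + 1), (-1 : ℂ) ^ m * (n.choose m : ℂ) *
      ((A m + (m : ℂ) * B m) / φ n (m + 1)) *
      (∑ k ∈ Finset.range (m + 1), (-1 : ℂ) ^ k * (m.choose k : ℂ) * (φ k m * g k)) = g n := by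
  have ext : ∀ m ∈ Finset.range (n + 1),
      (-1 : ℂ) ^ m * (n.choose m : ℂ) * ((A m + (m : ℂ) * B m) / φ n (m + 1)) *
      (∑ k ∈ Finset.range (m + 1), (-1 : ℂ) ^ k * (m.choose k : ℂ) * (φ k m * g k))
      = ∑ k ∈ Finset.range (n + 1), (-1 : ℂ) ^ m * (n.choose m : ℂ) *
        ((A m + (m : ℂ) * B m) / φ n (m + 1)) *
        ((-1 : ℂ) ^ k * (m.choose k : ℂ) * (φ k m * g k)) := by
    intro m hm
    rw [← Finset.mul_sum]
    congr 1
    apply Finset.sum_subset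
    · intro k; simp only [Finset.mem_range] at hm ⊢; omega
    · intro k _ hk
      rw [Nat.choose_eq_zero_of_lt (by simpa using hk)]; simp
  rw [Finset.sum_congr rfl ext, Finset.sum_comm]
  have key : ∀ k ∈ Finset.range (n + 1), ∑ m ∈ Finset.range (n + 1),
      (-1 : ℂ) ^ m * (n.choose m : ℂ) * ((A m + (m : ℂ) * B m) / φ n (m + 1)) *
        ((-1 : ℂ) ^ k * (m.choose k : ℂ) * (φ k m * g k)) = if k = n then g n else 0 := by
    intro k hk
    have hk : k ≤ n := by simpa [Nat.lt_succ_iff] using hk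
    obtain ⟨N, rfl⟩ := Nat.exists_eq_add_of_le hk
    rw [add_assoc, Finset.sum_range_add]
    have z : ∑ m ∈ Finset.range k, (-1 : ℂ) ^ m * ((k + N).choose m : ℂ) *
        ((A m + (m : ℂ) * B m) / φ ((k + N : ℕ) : ℂ) (m + 1)) *
        ((-1 : ℂ) ^ k * (m.choose k : ℂ) * (φ k m * g k)) = 0 := by
      apply Finset.sum_eq_zero
      intro m hm
      rw [Nat.choose_eq_zero_of_lt (show m < k by simpa using hm)]; simp
    rw [z, zero_add]
    have sgn : (-1 : ℂ) ^ k * (-1) ^ k = 1 := by rw [← mul_pow]; simp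
    have s : ∀ j ∈ Finset.range (N + 1), (-1 : ℂ) ^ (k + j) * ((k + N).choose (k + j) : ℂ) *
        ((A (k + j) + ((k + j : ℕ) : ℂ) * B (k + j)) / φ ((k + N : ℕ) : ℂ) (k + j + 1)) *
        ((-1 : ℂ) ^ k * ((k + j).choose k : ℂ) * (φ k (k + j) * g k))
        = (g k * ((k + N).choose k : ℂ)) * ((-1 : ℂ) ^ j * (N.choose j : ℂ) *
      ((A (k + j) + ((k + j : ℕ) : ℂ) * B (k + j)) * φ k (k + j) / φ ((k + N : ℕ) : ℂ) (k + j + 1))) := by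
      intro j hj
      have hj : j ≤ N := by simpa [Nat.lt_succ_iff] using hj
      have cc : ((k + N).choose (k + j) : ℂ) * ((k + j).choose k : ℂ)
          = ((k + N).choose k : ℂ) * (N.choose j : ℂ) := by
        have := Nat.choose_mul (n := k + N) (k := k + j) (s := k) (by omega)
        simp only [Nat.add_sub_cancel_left] at this
        exact_mod_cast this
      rw [pow_add]
      linear_combination ((-1 : ℂ) ^ k * (-1) ^ k * (-1) ^ j *
        (A (k + j) + ((k + j : ℕ) : ℂ) * B (k + j)) / φ ((k + N : ℕ) : ℂ) (k + j + 1)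
        * φ k (k + j) * g k) * cc + (((k + N).choose k : ℂ) * (N.choose j : ℂ) * (-1) ^ j *
        (A (k + j) + ((k + j : ℕ) : ℂ) * B (k + j)) / φ ((k + N : ℕ) : ℂ) (k + j + 1)
        * φ k (k + j) * g k) * sgn
    rw [Finset.sum_congr rfl s, ← Finset.mul_sum]
    rcases N with _ | M
    · have := hn k (by omega)
      simp only [add_zero] at this
      simp only [zero_add, Finset.sum_range_one, add_zero, pow_zero, Nat.choose_self, if_true]
      rw [hφ] at this ⊢
      have l := left_ne_zero_of_mul this
      have r := right_ne_zero_of_mul this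
      field_simp
      simp
    · rw [gh_tel φ A B hφ k M (M + 1) _ (by push_cast; ring) fun j hj => hn _ (by omega)]
      simp
  rw [Finset.sum_congr rfl key]
  simp

theorem sum_parity (G : ℕ → ℂ) (n : ℕ) : ∑ m ∈ Finset.range (n + 1), G m =
    ∑ k ∈ Finset.range (n / 2 + 1), G (2 * k) + ∑ k ∈ Finset.range ((n + 1) / 2), G (2 * k + 1) := by
  induction n with
  | zero => simp
  | succ n ih =>
    rw [Finset.sum_range_succ, ih]
    rcases Nat.even_or_odd' n with ⟨p, rfl | rfl⟩
    · have e1 : 2 * p / 2 = p := by omega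
      have e2 : (2 * p + 1) / 2 = p := by omega
      have e3 : (2 * p + 1 + 1) / 2 = p + 1 := by omega
      rw [e1, e2, e3, Finset.sum_range_succ (fun k => G (2 * k + 1))]; ring
    · have e2 : (2 * p + 1) / 2 = p := by omega
      have e3 : (2 * p + 1 + 1) / 2 = p + 1 := by omega
      have e4 : (2 * p + 1 + 1 + 1) / 2 = p + 1 := by omega
      rw [e2, e3, e4, Finset.sum_range_succ (fun k => G (2 * k)) (p + 1)]
      rw [show 2 * (p + 1) = 2 * p + 1 + 1 by ring]; ring

/-- Fourth-type reciprocal relation dual to the Chu–Vandermonde–Gauß summation formula,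
first form. -/
theorem cvg_reciprocal_fourth_first (n : ℕ) (a c : ℂ)
    (hc : ∀ j : ℕ, j < n → c + (j : ℂ) ≠ 0)
    (hcn : ∀ j : ℕ, j ≤ n / 2 → 1 - c - (n : ℂ) + (j : ℂ) ≠ 0)
    (hca : ∀ j : ℕ, j < (n + 1) / 2 → c - a + (n : ℂ) + (j : ℂ) ≠ 0) :
    poch (c - a) n / poch c n =
      (∑ k ∈ Finset.range (n / 2 + 1),
        (n.choose (2 * k) : ℂ) *
          ((-1 : ℂ) ^ k * (1 - c - (k : ℂ)) * poch (1 - a) (2 * k) * poch (c - a) k) /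
          (poch (c - a + (n : ℂ)) k * poch (1 - c - (n : ℂ)) (k + 1) * poch c k)) -
      ∑ k ∈ Finset.range ((n + 1) / 2),
        (n.choose (2 * k + 1) : ℂ) *
          ((-1 : ℂ) ^ k * (1 + c - a + 3 * (k : ℂ)) * poch (1 - a) (2 * k + 1) *
            poch (c - a) k) /
          (poch (c - a + (n : ℂ)) (k + 1) * poch (1 - c - (n : ℂ)) (k + 1) * poch c k) := by
  have H := gh_inv (fun x m => poch (c - a + x) (m / 2) * poch (1 - c - x) ((m + 1) / 2))
    (fun m => if m % 2 = 0 then 1 - c + ((m / 2 : ℕ) : ℂ) else c - a + ((m / 2 : ℕ) : ℂ))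
    (fun m => if m % 2 = 0 then -1 else 1)
    (fun k => poch (c - a) k / poch c k)
    (by
      intro x m
      rcases Nat.even_or_odd' m with ⟨p, rfl | rfl⟩
      · have e1 : 2 * p / 2 = p := by omega
        have e2 : (2 * p + 1) / 2 = p := by omega
        have e3 : (2 * p + 1 + 1) / 2 = p + 1 := by omega
        have e4 : 2 * p % 2 = 0 := by omega
        simp only [e1, e2, e3, e4, if_true, poch]; ring
      · have e2 : (2 * p + 1) / 2 = p := by omega
        have e3 : (2 * p + 1 + 1) / 2 = p + 1 := by omega
        have e4 : (2 * p + 1 + 1 + 1) / 2 = p + 1 := by omega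
        have e5 : ¬ ((2 * p + 1) % 2 = 0) := by omega
        simp only [e2, e3, e4, e5, if_false, poch]; ring)
    n
    (by
      intro j hj
      apply mul_ne_zero
      · exact poch_ne _ _ fun i hi => hca i (by omega)
      · exact poch_ne _ _ fun i hi => hcn i (by omega))
  rw [← H, sum_parity]
  refine Eq.trans ?_ (sub_eq_add_neg _ _).symm
  rw [← Finset.sum_neg_distrib]
  congr 1
  · apply Finset.sum_congr rfl
    intro k hk
    have hk : k ≤ n / 2 := by simpa [Nat.lt_succ_iff] using hk
    have e1 : 2 * k / 2 = k := by omega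
    have e2 : (2 * k + 1) / 2 = k := by omega
    have e3 : (2 * k + 1 + 1) / 2 = k + 1 := by omega
    have e4 : 2 * k % 2 = 0 := by omega
    have D := direct_sum a c k k fun j hj => hc j (by omega)
    rw [← two_mul] at D
    simp only [e1, e2, e3, e4, if_true]
    rw [D]
    have e : 1 - a - k + (k : ℂ) = 1 - a := by ring
    have s : (-1 : ℂ) ^ (2 * k) = 1 := by rw [pow_mul]; simp
    rw [e, s]
    push_cast
    simp only [div_eq_mul_inv, mul_inv]
    ring
  · apply Finset.sum_congr rfl
    intro k hk
    have hk : k < (n + 1) / 2 := by simpa using hk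
    have e2 : (2 * k + 1) / 2 = k := by omega
    have e3 : (2 * k + 1 + 1) / 2 = k + 1 := by omega
    have e4 : (2 * k + 1 + 1 + 1) / 2 = k + 1 := by omega
    have e5 : ¬ ((2 * k + 1) % 2 = 0) := by omega
    have D := direct_sum a c k (k + 1) fun j hj => hc j (by omega)
    rw [← add_assoc, ← two_mul] at D
    simp only [e2, e3, e4, e5, if_false]
    rw [D]
    have e : 1 - a - k + (k : ℂ) = 1 - a := by ring
    have s : (-1 : ℂ) ^ (2 * k + 1) = -1 := by rw [pow_succ, pow_mul]; simp
    rw [e, s]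
    push_cast
    simp only [div_eq_mul_inv, mul_inv]
    ring
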